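/- Two-point NH lemma: For every a, b in the Heisenberg group and every horizontal line L ⊂ ℍ (a set of the form {p·δ_r(q) : r ∈ ℝ} for fixed p ∈ ℍ and horizontal q = (x,y,0) ≠ 0, where δ_r(x,y,0)=(rx,ry,0)), we have max{d(a,L), d(b,L)} ≥ (1/16)·NH(a⁻¹b)²/d(a,b), where d is the Korányi metric, NH(x,y,z)=|z|^{1/2}, and d(a,L) = inf_{w ∈ L} d(a,w). -/

import Mathlib

open MeasureTheory Filter Topology

noncomputable section

abbrev H : Type := ℝ × ℝ × ℝ

/-- Heisenberg group multiplication. -/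
def Hmul (p q : H) : H :=
  (p.1 + q.1, p.2.1 + q.2.1, p.2.2 + q.2.2 + (p.1 * q.2.1 - p.2.1 * q.1) / 2)

/-- Heisenberg group inverse. -/
def Hinv (p : H) : H := (-p.1, -p.2.1, -p.2.2)

/-- Korányi norm. -/
def KN (p : H) : ℝ := ((p.1 ^ 2 + p.2.1 ^ 2) ^ 2 + p.2.2 ^ 2) ^ ((1 : ℝ) / 4)

/-- The non-horizontal component norm. -/
def NH (p : H) : ℝ := |p.2.2| ^ ((1 : ℝ) / 2)

/-- Korányi metric. -/
def Hd (p q : H) : ℝ := KN (Hmul (Hinv q) p)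

/-- Horizontal projection. -/
def Hpi (p : H) : ℝ × ℝ := (p.1, p.2.1)

/-- Heisenberg dilation. -/
def Hdil (r : ℝ) (p : H) : H := (r * p.1, r * p.2.1, r ^ 2 * p.2.2)

/-- Euclidean norm on ℝ². -/
def nrm2 (u : ℝ × ℝ) : ℝ := Real.sqrt (u.1 ^ 2 + u.2 ^ 2)

/-- Korányi distance from a point to the horizontal line through `p` with
horizontal direction `v`. -/
def dLine (a p : H) (v : ℝ × ℝ) : ℝ := ⨅ r : ℝ, Hd a (Hmul p (r * v.1, r * v.2, 0))

/-- Euclidean distance from `v` to the affine line through `u` and `w` in ℝ². -/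
def distLine2 (v u w : ℝ × ℝ) : ℝ := ⨅ t : ℝ, nrm2 (v - (u + t • (w - u)))

/-- Unsigned area of the triangle with vertices `u`, `v`, `w` in ℝ². -/
def triArea (u v w : ℝ × ℝ) : ℝ :=
  |(v.1 - u.1) * (w.2 - u.2) - (v.2 - u.2) * (w.1 - u.1)| / 2

lemma KN_nonneg (p : H) : 0 ≤ KN p := by
  unfold KN; positivity

lemma KN_pow_four (p : H) : KN p ^ 4 = (p.1 ^ 2 + p.2.1 ^ 2) ^ 2 + p.2.2 ^ 2 := by
  unfold KN
  rw [← Real.rpow_natCast, ← Real.rpow_mul (by positivity)]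
  norm_num

lemma horizontal_sq_le_KN_sq (p : H) : p.1 ^ 2 + p.2.1 ^ 2 ≤ KN p ^ 2 := by
  refine le_of_abs_le (abs_le_of_sq_le_sq ?_ (sq_nonneg _))
  nlinarith [KN_pow_four p, sq_nonneg p.2.2]

lemma abs_vertical_le_KN_sq (p : H) : |p.2.2| ≤ KN p ^ 2 := by
  refine abs_le_of_sq_le_sq ?_ (sq_nonneg _)
  nlinarith [KN_pow_four p, sq_nonneg (p.1 ^ 2 + p.2.1 ^ 2)]

lemma NH_sq (p : H) : NH p ^ 2 = |p.2.2| := by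
  unfold NH
  rw [← Real.rpow_natCast, ← Real.rpow_mul (abs_nonneg _)]
  norm_num

lemma abs_wedge_le {x y x' y' A B : ℝ} (hA : 0 ≤ A) (hB : 0 ≤ B)
    (h : x ^ 2 + y ^ 2 ≤ A ^ 2) (h' : x' ^ 2 + y' ^ 2 ≤ B ^ 2) :
    |x * y' - y * x'| ≤ A * B := by
  refine abs_le_of_sq_le_sq ?_ (mul_nonneg hA hB)
  nlinarith [mul_le_mul h h' (by positivity) (by positivity), sq_nonneg (x * x' + y * y')]

lemma abs_wedge_KN_le (p q : H) : |p.1 * q.2.1 - p.2.1 * q.1| ≤ KN p * KN q :=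
  abs_wedge_le (KN_nonneg p) (KN_nonneg q) (horizontal_sq_le_KN_sq p) (horizontal_sq_le_KN_sq q)

lemma KN_Hinv (p : H) : KN (Hinv p) = KN p := by
  simp [KN, Hinv]

lemma Hinv_Hmul_swap (a b : H) : Hinv (Hmul (Hinv a) b) = Hmul (Hinv b) a := by
  ext <;> simp only [Hinv, Hmul] <;> ring

lemma Hd_eq_KN_Hinv_Hmul (a b : H) : Hd a b = KN (Hmul (Hinv a) b) := by
  rw [Hd, ← Hinv_Hmul_swap, KN_Hinv]

/-- The vertical part of `a⁻¹ b` is controlled by the distances from `a` and `b` to points of a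
common horizontal line. -/
lemma abs_vertical_le_of_line (a b p : H) (v : ℝ × ℝ) (r s : ℝ) :
    |(Hmul (Hinv a) b).2.2| ≤
      Hd a (Hmul p (r * v.1, r * v.2, 0)) ^ 2 + Hd b (Hmul p (s * v.1, s * v.2, 0)) ^ 2 +
      Hd a b * (Hd a (Hmul p (r * v.1, r * v.2, 0)) + Hd b (Hmul p (s * v.1, s * v.2, 0))) / 2 +
      Hd a (Hmul p (r * v.1, r * v.2, 0)) * Hd b (Hmul p (s * v.1, s * v.2, 0)) / 2 := by
  rw [Hd_eq_KN_Hinv_Hmul a b]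
  unfold Hd
  set g := Hmul (Hinv (Hmul p (r * v.1, r * v.2, 0))) a with hg
  set h := Hmul (Hinv (Hmul p (s * v.1, s * v.2, 0))) b with hh
  set u := Hmul (Hinv a) b with hu'
  have key : u.2.2 = h.2.2 - g.2.2 + (u.1 * g.2.1 - u.2.1 * g.1) / 2
      + (u.1 * h.2.1 - u.2.1 * h.1) / 2 + (g.1 * h.2.1 - g.2.1 * h.1) / 2 := by
    simp only [hg, hh, hu', Hmul, Hinv]; ring
  have h1 := abs_le.mp (abs_vertical_le_KN_sq g)
  have h2 := abs_le.mp (abs_vertical_le_KN_sq h)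
  have h3 := abs_le.mp (abs_wedge_KN_le u g)
  have h4 := abs_le.mp (abs_wedge_KN_le u h)
  have h5 := abs_le.mp (abs_wedge_KN_le g h)
  rw [key, abs_le]
  constructor <;> linarith [h1.1, h1.2, h2.1, h2.2, h3.1, h3.2, h4.1, h4.2, h5.1, h5.2]

lemma le_max_Hd_line (a b p : H) (v : ℝ × ℝ) (r s : ℝ) :
    (1 / 16) * NH (Hmul (Hinv a) b) ^ 2 / Hd a b ≤
      max (Hd a (Hmul p (r * v.1, r * v.2, 0))) (Hd b (Hmul p (s * v.1, s * v.2, 0))) := by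
  have hline := abs_vertical_le_of_line a b p v r s
  have hz : |(Hmul (Hinv a) b).2.2| ≤ Hd a b ^ 2 := by
    rw [Hd_eq_KN_Hinv_Hmul]
    exact abs_vertical_le_KN_sq _
  have hA : 0 ≤ Hd a (Hmul p (r * v.1, r * v.2, 0)) := KN_nonneg _
  have hB : 0 ≤ Hd b (Hmul p (s * v.1, s * v.2, 0)) := KN_nonneg _
  have hl : 0 ≤ Hd a b := KN_nonneg _
  rw [NH_sq]
  generalize Hd a (Hmul p (r * v.1, r * v.2, 0)) = A at *
  generalize Hd b (Hmul p (s * v.1, s * v.2, 0)) = B at *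
  generalize Hd a b = l at *
  generalize |(Hmul (Hinv a) b).2.2| = z at *
  rcases hl.eq_or_lt with rfl | hl
  · simpa using Or.inl hA
  by_contra! hlt
  obtain ⟨hAc, hBc⟩ := max_lt_iff.mp hlt
  obtain ⟨c, hc⟩ : ∃ c, c = 1 / 16 * z / l := ⟨_, rfl⟩
  rw [← hc] at hAc hBc
  have hzc : z = 16 * (l * c) := by rw [hc]; field_simp
  have hcl : 16 * c ≤ l := by nlinarith
  have hc0 : 0 < c := hA.trans_lt hAc
  have hA2 : A ^ 2 ≤ c ^ 2 := by gcongr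
  have hB2 : B ^ 2 ≤ c ^ 2 := by gcongr
  have hAB : A * B ≤ c * c := by gcongr
  have hlAB : l * (A + B) ≤ l * (c + c) := by gcongr
  nlinarith [mul_pos hl hc0, mul_le_mul_of_nonneg_right hcl hc0.le]

/-- Two-point NH lemma: two points cannot both be close to a horizontal line
compared with the vertical part of their difference. -/
theorem two_point_NH :
    ∀ (a b p : H) (v : ℝ × ℝ), v ≠ 0 → a ≠ b →
      max (dLine a p v) (dLine b p v) ≥
        (1 / 16) * NH (Hmul (Hinv a) b) ^ 2 / Hd a b := by
  intro a b p v _ _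
  by_contra! hlt
  obtain ⟨ha, hb⟩ := max_lt_iff.mp hlt
  obtain ⟨r, hr⟩ := exists_lt_of_ciInf_lt ha
  obtain ⟨s, hs⟩ := exists_lt_of_ciInf_lt hb
  exact (le_max_Hd_line a b p v r s).not_gt (max_lt hr hs)
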